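/- Let G be a group and let x_1, …, x_10 ∈ G satisfy: x_i² = e for i = 1,…,10; (x_i x_j)³ = e for each pair {i,j} ∈ {{1,2},{1,4},{2,3},{3,5},{4,6},{5,10},{6,7},{7,8},{8,9},{9,10}}; (x_5 · x_10 x_9 x_10)³ = e; (x_5 · x_10 x_9 x_10 x_8 x_10 x_9 x_10)³ = e; (x_5 · x_10 x_9 x_10 x_8 x_10 x_9 x_10 x_7 x_10 x_9 x_10 x_8 x_10 x_9 x_10)³ = e; x_4 x_3 x_2 x_1 x_2 x_3 x_4 = x_6 x_7 x_10 x_9 x_10 x_8 x_10 x_9 x_10 x_7 x_5 x_7 x_10 x_9 x_10 x_8 x_10 x_9 x_10 x_7 x_6; and (x_i x_j)² = e for each pair {i,j} ∈ {{1,3},{1,5},{1,6},{1,7},{1,8},{1,9},{1,10},{2,6},{2,7},{2,8},{2,9},{2,10},{3,4},{3,6},{3,7},{3,8},{3,9},{3,10},{4,8},{4,9},{4,10},{5,6},{6,8},{6,9},{6,10},{7,9},{7,10},{8,10}}. Then x_4 commutes with x_7 and x_5 commutes with x_7, i.e., (x_4 x_7)² = e and (x_5 x_7)² = e. -/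

import Mathlib

section InvolutionRelations

variable {G : Type*} [Group G] {a b c k : G}

theorem commute_of_mul_sq_eq_one (ha : a * a = 1) (hb : b * b = 1) (h : (a * b) ^ 2 = 1) :
    Commute a b := by
  have h' : a * b * (a * b) = 1 := by rw [← sq, h]
  calc a * b = (a * b)⁻¹ := eq_inv_of_mul_eq_one_left h'
    _ = b * a := by
      rw [mul_inv_rev, inv_eq_of_mul_eq_one_right ha, inv_eq_of_mul_eq_one_right hb]

theorem mul_sq_eq_one_of_commute (ha : a * a = 1) (hb : b * b = 1) (h : Commute a b) :
    (a * b) ^ 2 = 1 := by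
  rw [h.mul_pow, sq, sq, ha, hb, one_mul]

theorem braid_of_mul_pow_three_eq_one (ha : a * a = 1) (hb : b * b = 1)
    (h : (a * b) ^ 3 = 1) : a * b * a = b * a * b := by
  have h' : a * b * a * (b * a * b) = 1 := by
    rw [← h]
    simp only [pow_succ, pow_zero, one_mul, mul_assoc]
  calc a * b * a = (b * a * b)⁻¹ := eq_inv_of_mul_eq_one_left h'
    _ = b * a * b := by
      rw [mul_inv_rev, mul_inv_rev, inv_eq_of_mul_eq_one_right ha,
        inv_eq_of_mul_eq_one_right hb, mul_assoc]

theorem conj_mul_self (hk : k * k = 1) (ha : a * a = 1) : k * a * k * (k * a * k) = 1 := by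
  calc k * a * k * (k * a * k) = k * a * (k * k) * a * k := by simp only [mul_assoc]
    _ = k * (a * a) * k := by rw [hk]; simp only [mul_assoc, one_mul]
    _ = 1 := by rw [ha, mul_one, hk]

theorem conj_conj_eq_self (hk : k * k = 1) : k * (k * a * k) * k = a := by
  calc k * (k * a * k) * k = (k * k) * a * (k * k) := by simp only [mul_assoc]
    _ = a := by rw [hk, one_mul, mul_one]

theorem Commute.conj_eq_self (h : Commute k a) (hk : k * k = 1) : k * a * k = a := by
  rw [h.eq, mul_assoc, hk, mul_one]

theorem Commute.conj_right (h : Commute a b) (hk : Commute a k) : Commute a (k * b * k) :=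
  (hk.mul_right h).mul_right hk

theorem conj_mul_conj (hk : k * k = 1) : k * a * k * (k * b * k) = k * (a * b) * k := by
  calc k * a * k * (k * b * k) = k * a * (k * k) * b * k := by simp only [mul_assoc]
    _ = k * (a * b) * k := by rw [hk]; simp only [mul_assoc, one_mul]

theorem commute_conj (h : Commute a b) (hk : k * k = 1) :
    Commute (k * a * k) (k * b * k) := by
  rw [Commute, SemiconjBy, conj_mul_conj hk, conj_mul_conj hk, h.eq]

theorem braid_conj (h : a * b * a = b * a * b) (hk : k * k = 1) :
    k * a * k * (k * b * k) * (k * a * k) = k * b * k * (k * a * k) * (k * b * k) := by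
  simp only [conj_mul_conj hk, h]

theorem braid_conj_right (h : a * b * a = b * a * b) (hk : k * k = 1) (hka : Commute k a) :
    a * (k * b * k) * a = k * b * k * a * (k * b * k) := by
  simpa only [hka.conj_eq_self hk] using braid_conj h hk

theorem Commute.conj_conj_comm (h : Commute a k) :
    a * (k * b * k) * a = k * (a * b * a) * k := by
  calc a * (k * b * k) * a = (a * k) * b * (k * a) := by simp only [mul_assoc]
    _ = (k * a) * b * (a * k) := by rw [h.eq]
    _ = k * (a * b * a) * k := by simp only [mul_assoc]

/-- In the symmetric group on four letters, the transposition `(2 3)` commutes with `(1 4)`. -/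
theorem commute_middle_of_braid (hab : a * b * a = b * a * b) (hac : Commute a c) :
    Commute b (a * (b * c * b) * a) := by
  calc b * (a * (b * c * b) * a) = (b * a * b) * c * b * a := by simp only [mul_assoc]
    _ = a * b * (a * c) * b * a := by rw [← hab]; simp only [mul_assoc]
    _ = a * b * c * (a * b * a) := by rw [hac.eq]; simp only [mul_assoc]
    _ = a * (b * c * b) * a * b := by rw [hab]; simp only [mul_assoc]

end InvolutionRelations

theorem zappatic_E10_x4_x5_comm_x7 {G : Type*} [Group G]
    (x1 x2 x3 x4 x5 x6 x7 x8 x9 x10 : G)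
    (h1 : x1 ^ 2 = 1) (h2 : x2 ^ 2 = 1) (h3 : x3 ^ 2 = 1) (h4 : x4 ^ 2 = 1)
    (h5 : x5 ^ 2 = 1) (h6 : x6 ^ 2 = 1) (h7 : x7 ^ 2 = 1) (h8 : x8 ^ 2 = 1)
    (h9 : x9 ^ 2 = 1) (h10 : x10 ^ 2 = 1)
    (b12 : (x1 * x2) ^ 3 = 1) (b14 : (x1 * x4) ^ 3 = 1) (b23 : (x2 * x3) ^ 3 = 1)
    (b35 : (x3 * x5) ^ 3 = 1) (b46 : (x4 * x6) ^ 3 = 1) (b5_10 : (x5 * x10) ^ 3 = 1)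
    (b67 : (x6 * x7) ^ 3 = 1) (b78 : (x7 * x8) ^ 3 = 1) (b89 : (x8 * x9) ^ 3 = 1)
    (b9_10 : (x9 * x10) ^ 3 = 1)
    (blong1 : (x5 * (x10 * x9 * x10)) ^ 3 = 1)
    (blong2 : (x5 * (x10 * x9 * x10 * x8 * x10 * x9 * x10)) ^ 3 = 1)
    (blong3 : (x5 * (x10 * x9 * x10 * x8 * x10 * x9 * x10 * x7 *
        x10 * x9 * x10 * x8 * x10 * x9 * x10)) ^ 3 = 1)
    (hstar : x4 * x3 * x2 * x1 * x2 * x3 * x4 =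
      x6 * x7 * x10 * x9 * x10 * x8 * x10 * x9 * x10 * x7 *
        x5 * x7 * x10 * x9 * x10 * x8 * x10 * x9 * x10 * x7 * x6)
    (c13 : (x1 * x3) ^ 2 = 1) (c15 : (x1 * x5) ^ 2 = 1) (c16 : (x1 * x6) ^ 2 = 1)
    (c17 : (x1 * x7) ^ 2 = 1) (c18 : (x1 * x8) ^ 2 = 1) (c19 : (x1 * x9) ^ 2 = 1)
    (c1_10 : (x1 * x10) ^ 2 = 1)
    (c26 : (x2 * x6) ^ 2 = 1) (c27 : (x2 * x7) ^ 2 = 1) (c28 : (x2 * x8) ^ 2 = 1)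
    (c29 : (x2 * x9) ^ 2 = 1) (c2_10 : (x2 * x10) ^ 2 = 1)
    (c34 : (x3 * x4) ^ 2 = 1) (c36 : (x3 * x6) ^ 2 = 1) (c37 : (x3 * x7) ^ 2 = 1)
    (c38 : (x3 * x8) ^ 2 = 1) (c39 : (x3 * x9) ^ 2 = 1) (c3_10 : (x3 * x10) ^ 2 = 1)
    (c48 : (x4 * x8) ^ 2 = 1) (c49 : (x4 * x9) ^ 2 = 1) (c4_10 : (x4 * x10) ^ 2 = 1)
    (c56 : (x5 * x6) ^ 2 = 1)
    (c68 : (x6 * x8) ^ 2 = 1) (c69 : (x6 * x9) ^ 2 = 1) (c6_10 : (x6 * x10) ^ 2 = 1)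
    (c79 : (x7 * x9) ^ 2 = 1) (c7_10 : (x7 * x10) ^ 2 = 1)
    (c8_10 : (x8 * x10) ^ 2 = 1) :
    (x4 * x7) ^ 2 = 1 ∧ (x5 * x7) ^ 2 = 1 := by
  rw [sq] at h1 h2 h3 h4 h5 h6 h7 h8 h9 h10
  replace b12 := braid_of_mul_pow_three_eq_one h1 h2 b12
  replace b14 := braid_of_mul_pow_three_eq_one h1 h4 b14
  replace b67 := braid_of_mul_pow_three_eq_one h6 h7 b67
  replace b78 := braid_of_mul_pow_three_eq_one h7 h8 b78
  replace b89 := braid_of_mul_pow_three_eq_one h8 h9 b89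
  replace b9_10 := braid_of_mul_pow_three_eq_one h9 h10 b9_10
  replace c13 := commute_of_mul_sq_eq_one h1 h3 c13
  replace c15 := commute_of_mul_sq_eq_one h1 h5 c15
  replace c16 := commute_of_mul_sq_eq_one h1 h6 c16
  replace c17 := commute_of_mul_sq_eq_one h1 h7 c17
  replace c18 := commute_of_mul_sq_eq_one h1 h8 c18
  replace c19 := commute_of_mul_sq_eq_one h1 h9 c19
  replace c1_10 := commute_of_mul_sq_eq_one h1 h10 c1_10
  replace c27 := commute_of_mul_sq_eq_one h2 h7 c27
  replace c28 := commute_of_mul_sq_eq_one h2 h8 c28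
  replace c29 := commute_of_mul_sq_eq_one h2 h9 c29
  replace c2_10 := commute_of_mul_sq_eq_one h2 h10 c2_10
  replace c34 := commute_of_mul_sq_eq_one h3 h4 c34
  replace c37 := commute_of_mul_sq_eq_one h3 h7 c37
  replace c38 := commute_of_mul_sq_eq_one h3 h8 c38
  replace c39 := commute_of_mul_sq_eq_one h3 h9 c39
  replace c3_10 := commute_of_mul_sq_eq_one h3 h10 c3_10
  replace c48 := commute_of_mul_sq_eq_one h4 h8 c48
  replace c49 := commute_of_mul_sq_eq_one h4 h9 c49
  replace c4_10 := commute_of_mul_sq_eq_one h4 h10 c4_10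
  replace c56 := commute_of_mul_sq_eq_one h5 h6 c56
  replace c68 := commute_of_mul_sq_eq_one h6 h8 c68
  replace c69 := commute_of_mul_sq_eq_one h6 h9 c69
  replace c6_10 := commute_of_mul_sq_eq_one h6 h10 c6_10
  replace c79 := commute_of_mul_sq_eq_one h7 h9 c79
  replace c7_10 := commute_of_mul_sq_eq_one h7 h10 c7_10
  replace c8_10 := commute_of_mul_sq_eq_one h8 h10 c8_10
  -- With `x6, …, x10` acting as `(0 1), …, (4 5)`, `p`, `t`, `u` are `(3 5)`, `(2 5)`, `(1 5)`.
  obtain ⟨p, hp⟩ : ∃ p, p = x10 * x9 * x10 := ⟨_, rfl⟩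
  obtain ⟨t, ht⟩ : ∃ t, t = p * x8 * p := ⟨_, rfl⟩
  obtain ⟨u, hu⟩ : ∃ u, u = t * x7 * t := ⟨_, rfl⟩
  obtain ⟨s, hs⟩ : ∃ s, s = x3 * (x2 * x1 * x2) * x3 := ⟨_, rfl⟩
  have pp : p * p = 1 := hp ▸ conj_mul_self h10 h9
  have tt : t * t = 1 := ht ▸ conj_mul_self pp h8
  have uu : u * u = 1 := hu ▸ conj_mul_self tt h7
  have ss : s * s = 1 := hs ▸ conj_mul_self h3 (conj_mul_self h2 h1)
  have c7p : Commute x7 p := hp ▸ c79.conj_right c7_10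
  have b8p : x8 * p * x8 = p * x8 * p := hp ▸ braid_conj_right b89 h10 c8_10.symm
  have ht' : t = x8 * p * x8 := by rw [ht, b8p]
  have b7t : x7 * t * x7 = t * x7 * t := ht ▸ braid_conj_right b78 pp c7p.symm
  have hu' : u = x7 * t * x7 := by rw [hu, b7t]
  have c6p : Commute x6 p := hp ▸ c69.conj_right c6_10
  have c6t : Commute x6 t := ht ▸ c68.conj_right c6p
  have b6u : x6 * u * x6 = u * x6 * u := hu ▸ braid_conj_right b67 tt c6t.symm
  have c8u : Commute x8 u := by
    have := commute_middle_of_braid b78 c7p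
    rwa [← ht', ← hu'] at this
  have c9t : Commute x9 t := by
    have := commute_middle_of_braid b89 c8_10
    rwa [b9_10, ← hp, ← ht'] at this
  have c9u : Commute x9 u := hu' ▸ c9t.conj_right c79.symm
  have hstar' : x4 * s * x4 = x6 * (u * x5 * u) * x6 := by
    rw [hs, hu', ht, hp]
    simpa only [mul_assoc] using hstar
  have b5u : x5 * u * x5 = u * x5 * u := by
    refine braid_of_mul_pow_three_eq_one h5 uu ?_
    rw [hu, ht, hp]
    simpa only [mul_assoc] using blong3
  have comm_inner {y : G} (hy6 : Commute y x6) (hy1 : Commute y x1) (hy2 : Commute y x2)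
      (hy3 : Commute y x3) (hy4 : Commute y x4) : Commute y (u * x5 * u) := by
    have h : Commute y (x4 * s * x4) :=
      (hs ▸ (hy1.conj_right hy2).conj_right hy3 : Commute y s).conj_right hy4
    rw [hstar'] at h
    simpa only [conj_conj_eq_self h6] using h.conj_right hy6
  have c58 : Commute x8 x5 := by
    simpa only [conj_conj_eq_self uu] using
      (comm_inner c68.symm c18.symm c28.symm c38.symm c48.symm).conj_right c8u
  have c59 : Commute x9 x5 := by
    simpa only [conj_conj_eq_self uu] using
      (comm_inner c69.symm c19.symm c29.symm c39.symm c49.symm).conj_right c9u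
  have b10p : x10 * p * x10 = p * x10 * p := by
    have := braid_conj b9_10 h10
    rw [← hp, show x10 * x10 * x10 = x10 by rw [h10, one_mul]] at this
    exact this.symm
  have b10u : x10 * u * x10 = u * x10 * u := by
    rw [hu', ht']
    exact braid_conj_right (braid_conj_right b10p h8 c8_10) h7 c7_10
  have c5w : Commute (x10 * u * x10) x5 := by
    rw [b10u]
    simpa only [conj_conj_eq_self uu] using
      commute_conj
        (comm_inner c6_10.symm c1_10.symm c2_10.symm c3_10.symm c4_10.symm) uu
  have hw : x10 * u * x10 = x9 * (x8 * x7 * x8) * x9 := by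
    rw [hu', ht', c7_10.symm.conj_conj_comm, c8_10.symm.conj_conj_comm, hp,
      conj_conj_eq_self h10, b89, c79.conj_conj_comm, b78]
  have c57 : Commute x5 x7 := by
    rw [hw] at c5w
    simpa only [conj_conj_eq_self h9, conj_conj_eq_self h8] using
      (c5w.symm.conj_right c59.symm).conj_right c58.symm
  have c7s : Commute x7 s := hs ▸ (c17.symm.conj_right c27.symm).conj_right c37.symm
  have c7r : Commute x7 (x4 * s * x4) := by
    have h := commute_middle_of_braid b67 c6t
    rw [← hu'] at h
    rw [hstar', ← b5u, c56.symm.conj_conj_comm]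
    exact h.conj_right c57.symm
  have c1r : Commute x1 (x4 * s * x4) := by
    have c1p : Commute x1 p := hp ▸ c19.conj_right c1_10
    have c1t : Commute x1 t := ht ▸ c18.conj_right c1p
    have c1u : Commute x1 u := hu ▸ c17.conj_right c1t
    exact hstar' ▸ (c15.conj_right c1u).conj_right c16
  have hs' : s = x1 * (x3 * x2 * x3) * x1 := by
    rw [hs, ← b12, c13.symm.conj_conj_comm]
  have c42 : Commute x4 x2 := by
    have h : Commute (x1 * x4 * x1) s := by
      rw [b14]
      simpa only [conj_conj_eq_self h4] using commute_conj c1r h4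
    rw [hs'] at h
    have h' := commute_conj h h1
    simp only [conj_conj_eq_self h1] at h'
    simpa only [conj_conj_eq_self h3] using h'.conj_right c34.symm
  have b4s : x4 * s * x4 = s * x4 * s :=
    hs ▸ braid_conj_right (braid_conj_right b14.symm h2 c42.symm) h3 c34
  have c74 : Commute x7 x4 := by
    simpa only [b4s, conj_conj_eq_self ss] using c7r.conj_right c7s
  exact ⟨mul_sq_eq_one_of_commute h4 h7 c74.symm, mul_sq_eq_one_of_commute h5 h7 c57⟩
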